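/- arXiv:1904.11954 — 9 statements merged into one kernel-verified Lean document; each statement's English description precedes it below -/
import Mathlib

section
/- Let β > 0, σ² > 0, and let d₀ > 2 be a real number. Define γ̄ = (1/2)·( β/σ² − log( 2 β d₀ e / ((d₀ − 2) σ²) ) ). Then for every real d ≥ d₀, 2·( 2 β d e / ((d − 2) σ²) )^{d/2 − 1} · e^{−β d/(2σ²)} ≤ ( (d₀ − 2) σ² / (β d₀ e) ) · e^{−γ̄ d}. -/
/-- The chain of inequalities in part (ii) of the anytime-reliability proposition
for adaptive-size CCM: the bound on the bit error probability at decoding delay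
`d ≥ d₀` decays exponentially with exponent `γbar`. -/
theorem stmt1 (β σ2 d₀ : ℝ) (hβ : 0 < β) (hσ : 0 < σ2) (hd₀ : 2 < d₀)
    (γbar : ℝ)
    (hγbar : γbar = (1/2) * (β / σ2 -
      Real.log (2 * β * d₀ * Real.exp 1 / ((d₀ - 2) * σ2))))
    (d : ℝ) (hd : d₀ ≤ d) :
    2 * (2 * β * d * Real.exp 1 / ((d - 2) * σ2)) ^ (d / 2 - 1) *
        Real.exp (-(β * d) / (2 * σ2)) ≤
      ((d₀ - 2) * σ2 / (β * d₀ * Real.exp 1)) * Real.exp (-γbar * d) := by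
  have he := Real.exp_pos 1
  have hd₀' : 0 < d₀ - 2 := by linarith
  have hd' : 0 < d - 2 := by linarith
  have hd_pos : 0 < d := by linarith
  have hd₀_pos : 0 < d₀ := by linarith
  have hbase : 2 * β * d * Real.exp 1 / ((d - 2) * σ2) ≤
      2 * β * d₀ * Real.exp 1 / ((d₀ - 2) * σ2) := by
    rw [div_le_div_iff₀ (by positivity) (by positivity)]
    have hc : 0 < β * Real.exp 1 * σ2 := by positivity
    linarith [mul_nonneg hc.le (sub_nonneg.2 hd)]
  have hinv : (d₀ - 2) * σ2 / (β * d₀ * Real.exp 1) =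
      2 * (2 * β * d₀ * Real.exp 1 / ((d₀ - 2) * σ2))⁻¹ := by
    field_simp
  have hpos : 0 < 2 * β * d₀ * Real.exp 1 / ((d₀ - 2) * σ2) := by positivity
  rw [hinv, hγbar]
  generalize 2 * β * d₀ * Real.exp 1 / ((d₀ - 2) * σ2) = A at hbase hpos ⊢
  have hexp : Real.exp (-((1/2) * (β / σ2 - Real.log A)) * d) =
      A ^ (d / 2) * Real.exp (-(β * d) / (2 * σ2)) := by
    rw [Real.rpow_def_of_pos hpos, ← Real.exp_add]
    congr 1
    field_simp
    ring
  calc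
    _ ≤ 2 * A ^ (d / 2 - 1) * Real.exp (-(β * d) / (2 * σ2)) := by
      gcongr
      linarith
    _ = _ := by
      rw [hexp, Real.rpow_sub_one hpos.ne']
      ring
end

section
/- Let (Ω, 𝒜, P) be a probability space, let K > 0, γ > 0, and let n ≥ 1 and d₀ ≥ 1 be integers. Let q : Ω → ℕ be a random variable such that for every integer d ≥ d₀ there exist measurable events B_{1,d}, …, B_{n,d} with {q ≥ d} = B_{1,d} ∪ ⋯ ∪ B_{n,d} and P(B_{j,d}) = K·e^{−γ(n+d−j)} for each j ∈ {1,…,n}. Then for every integer d ≥ d₀, P(q = d) ≤ K·( 1 + e^{−2γ}/(1 − e^{−γ}) )·e^{−γ d}. -/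
open MeasureTheory

/-- A finite geometric sum of exponentials, in reversed order, is bounded by the full series. -/
theorem sum_Icc_exp_le {γ : ℝ} (hγ : 0 < γ) (n : ℕ) :
    ∑ j ∈ Finset.Icc 1 n, Real.exp (-γ * ((n : ℝ) - (j : ℝ))) ≤ 1 / (1 - Real.exp (-γ)) := by
  have hx : 0 < 1 - Real.exp (-γ) := by
    have : Real.exp (-γ) < 1 := Real.exp_lt_one_iff.mpr (by linarith)
    linarith
  induction n with
  | zero => simpa using hx.le
  | succ n ih =>
    rw [Finset.sum_Icc_succ_top (by omega)]
    have hstep : ∑ j ∈ Finset.Icc 1 n, Real.exp (-γ * (((n + 1 : ℕ) : ℝ) - (j : ℝ)))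
        = Real.exp (-γ) * ∑ j ∈ Finset.Icc 1 n, Real.exp (-γ * ((n : ℝ) - (j : ℝ))) := by
      rw [Finset.mul_sum]
      refine Finset.sum_congr rfl fun j _ => ?_
      rw [← Real.exp_add]
      push_cast
      ring_nf
    rw [hstep, sub_self, mul_zero, Real.exp_zero]
    calc _ ≤ Real.exp (-γ) * (1 / (1 - Real.exp (-γ))) + 1 := by gcongr
      _ = 1 / (1 - Real.exp (-γ)) := by field_simp; ring

/-- Bound on the modulation-efficiency distribution of an anytime reliable
adaptive-size CCM scheme with feedback: if for every `d ≥ d₀` the event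
`{q ≥ d}` is the union of `n` bit-error events `B j` of probability
`K e^{−γ(n+d−j)}` (`j = 1,…,n`), then `P(q = d) ≤ K(1 + e^{−2γ}/(1−e^{−γ})) e^{−γ d}`. -/
theorem stmt3 {Ω : Type*} [MeasurableSpace Ω] (P : Measure Ω)
    [IsProbabilityMeasure P]
    (K γ : ℝ) (hK : 0 < K) (hγ : 0 < γ) (n d₀ : ℕ) (hn : 1 ≤ n) (hd₀ : 1 ≤ d₀)
    (q : Ω → ℕ)
    (hB : ∀ d : ℕ, d₀ ≤ d → ∃ B : ℕ → Set Ω,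
      (∀ j ∈ Finset.Icc 1 n, MeasurableSet (B j)) ∧
      ({ω | d ≤ q ω} = ⋃ j ∈ Finset.Icc 1 n, B j) ∧
      (∀ j ∈ Finset.Icc 1 n,
        P (B j) = ENNReal.ofReal (K * Real.exp (-γ * ((n : ℝ) + (d : ℝ) - (j : ℝ))))))
    (d : ℕ) (hd : d₀ ≤ d) :
    P {ω | q ω = d} ≤
      ENNReal.ofReal (K * (1 + Real.exp (-2 * γ) / (1 - Real.exp (-γ))) *
        Real.exp (-γ * d)) := by
  have hx : 0 < 1 - Real.exp (-γ) := by
    have : Real.exp (-γ) < 1 := Real.exp_lt_one_iff.mpr (by linarith)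
    linarith
  have hupper : P.real {ω | d ≤ q ω} ≤ K * Real.exp (-γ * d) * (1 / (1 - Real.exp (-γ))) := by
    obtain ⟨B, -, hU, hP⟩ := hB d hd
    rw [hU]
    calc P.real (⋃ j ∈ Finset.Icc 1 n, B j)
        ≤ ∑ j ∈ Finset.Icc 1 n, P.real (B j) := measureReal_biUnion_finset_le _ _
      _ = K * Real.exp (-γ * d) *
          ∑ j ∈ Finset.Icc 1 n, Real.exp (-γ * ((n : ℝ) - (j : ℝ))) := by
        rw [Finset.mul_sum]
        refine Finset.sum_congr rfl fun j hj => ?_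
        rw [measureReal_def, hP j hj, ENNReal.toReal_ofReal (by positivity), mul_assoc,
          ← Real.exp_add]
        ring_nf
      _ ≤ _ := by
        gcongr
        exact sum_Icc_exp_le hγ n
  obtain ⟨B, hM, hU, hP⟩ := hB (d + 1) (by omega)
  have hmeas : MeasurableSet {ω | d + 1 ≤ q ω} := by
    rw [hU]
    exact Finset.measurableSet_biUnion _ hM
  have hlower : K * Real.exp (-γ * d) * Real.exp (-γ) ≤ P.real {ω | d + 1 ≤ q ω} := by
    have hn' : n ∈ Finset.Icc 1 n := by simpa using hn
    calc K * Real.exp (-γ * d) * Real.exp (-γ) = P.real (B n) := by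
          rw [measureReal_def, hP n hn', ENNReal.toReal_ofReal (by positivity), mul_assoc,
            ← Real.exp_add]
          push_cast
          ring_nf
      _ ≤ P.real {ω | d + 1 ≤ q ω} := by
          rw [hU]
          exact measureReal_mono (Set.subset_biUnion_of_mem (u := B) hn') (measure_ne_top _ _)
  have hset : {ω | q ω = d} = {ω | d ≤ q ω} \ {ω | d + 1 ≤ q ω} := by
    ext ω
    simp only [Set.mem_ofPred_eq, Set.mem_sdiff]
    omega
  have hsub : {ω | d + 1 ≤ q ω} ⊆ {ω | d ≤ q ω} := fun ω hω => Nat.le_of_succ_le hω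
  rw [← ofReal_measureReal, hset, measureReal_sdiff hsub hmeas]
  apply ENNReal.ofReal_le_ofReal
  have hsq : Real.exp (-2 * γ) = Real.exp (-γ) * Real.exp (-γ) := by
    rw [← Real.exp_add]
    ring_nf
  calc _ ≤ K * Real.exp (-γ * d) * (1 / (1 - Real.exp (-γ))) -
        K * Real.exp (-γ * d) * Real.exp (-γ) := sub_le_sub hupper hlower
    _ = _ := by
      rw [hsq]
      field_simp
      ring
end

section
/- Let m_r ≥ 1 be an integer and let u = (u_1, u_2, …) ∈ {0,1}^ℕ be a binary sequence containing no run of more than m_r consecutive equal bits, i.e., there is no index i ≥ 1 with u_i = u_{i+1} = ⋯ = u_{i+m_r}. Then | Σ_{k=1}^∞ u_k 2^{−k} − 1/2 | ≥ 2^{−(m_r+2)}. -/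
theorem summable_mul_inv_two_pow_succ {x : ℕ → ℝ} (h0 : ∀ k, 0 ≤ x k) (h1 : ∀ k, x k ≤ 1) :
    Summable fun k => x k * (2:ℝ)⁻¹ ^ (k + 1) := by
  have hs : Summable fun k : ℕ => (2:ℝ)⁻¹ ^ (k + 1) :=
    (summable_nat_add_iff 1).2 (summable_geometric_of_lt_one (by norm_num) (by norm_num))
  exact hs.of_nonneg_of_le (fun k => mul_nonneg (h0 k) (by positivity))
    fun k => mul_le_of_le_one_left (by positivity) (h1 k)

theorem tsum_inv_two_pow_succ : ∑' k : ℕ, (2:ℝ)⁻¹ ^ (k + 1) = 1 := by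
  simp_rw [pow_succ, tsum_mul_right, tsum_geometric_inv_two]
  norm_num

/-- A binary expansion with leading digit `1` and another digit `1` at position `j ≤ n`
is at least `1 / 2 + 2⁻¹ ^ (n + 1)`. -/
theorem half_add_le_tsum_of_digits_eq_one {x : ℕ → ℝ} (h0 : ∀ k, 0 ≤ x k) (h1 : ∀ k, x k ≤ 1)
    {j n : ℕ} (hj : j ≠ 0) (hjn : j ≤ n) (hx0 : x 0 = 1) (hxj : x j = 1) :
    1 / 2 + (2:ℝ)⁻¹ ^ (n + 1) ≤ ∑' k : ℕ, x k * (2:ℝ)⁻¹ ^ (k + 1) := by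
  have hsum := (summable_mul_inv_two_pow_succ h0 h1).sum_le_tsum {0, j}
    fun k _ => mul_nonneg (h0 k) (by positivity)
  rw [Finset.sum_pair hj.symm, hx0, hxj] at hsum
  have hpow : (2:ℝ)⁻¹ ^ (n + 1) ≤ (2:ℝ)⁻¹ ^ (j + 1) :=
    pow_le_pow_of_le_one (by norm_num) (by norm_num) (by omega)
  norm_num at hsum hpow ⊢
  linarith

/-- Complementing all digits reflects a binary expansion about `1 / 2`. -/
theorem tsum_one_sub_mul_inv_two_pow_succ {x : ℕ → ℝ} (h0 : ∀ k, 0 ≤ x k) (h1 : ∀ k, x k ≤ 1) :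
    ∑' k : ℕ, (1 - x k) * (2:ℝ)⁻¹ ^ (k + 1) = 1 - ∑' k : ℕ, x k * (2:ℝ)⁻¹ ^ (k + 1) := by
  have hs : Summable fun k : ℕ => (2:ℝ)⁻¹ ^ (k + 1) :=
    (summable_nat_add_iff 1).2 (summable_geometric_of_lt_one (by norm_num) (by norm_num))
  simp_rw [sub_mul, one_mul]
  rw [hs.tsum_sub (summable_mul_inv_two_pow_succ h0 h1), tsum_inv_two_pow_succ]


/-- Key symbolic-dynamics estimate for BSM-based adaptive-bandwidth CCM:
if the binary sequence `u` (indexed from 1) contains no run of more than `mr`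
consecutive equal bits, then the point `M_BSM(u) = Σ_{k≥1} u_k 2^{−k}` stays at
distance at least `2^{−(mr+2)}` from the separation point `1/2`. -/
theorem stmt4 (mr : ℕ) (hmr : 1 ≤ mr) (u : ℕ → ℕ) (hu : ∀ k, u k = 0 ∨ u k = 1)
    (hrun : ¬ ∃ i : ℕ, 1 ≤ i ∧ ∀ t ≤ mr, u (i + t) = u i) :
    (2:ℝ)⁻¹ ^ (mr + 2) ≤
      |(∑' k : ℕ, (u (k + 1) : ℝ) * (2:ℝ)⁻¹ ^ (k + 1)) - 1 / 2| := by
  have h0 : ∀ k, (0:ℝ) ≤ u (k + 1) := fun k => Nat.cast_nonneg _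
  have h1 : ∀ k, (u (k + 1) : ℝ) ≤ 1 := fun k => by
    rcases hu (k + 1) with h | h <;> simp [h]
  obtain ⟨j, hj, hjn, heq⟩ : ∃ j, j ≠ 0 ∧ j ≤ mr + 1 ∧ u (j + 1) = u 1 := by
    by_contra! hne
    refine hrun ⟨2, by norm_num, fun t ht => ?_⟩
    have ht' := hne (t + 1) (by omega) (by omega)
    have h2 := hne 1 (by omega) (by omega)
    rw [show t + 1 + 1 = 2 + t by omega] at ht'
    have := hu (2 + t)
    have := hu 2
    have := hu 1
    norm_num at h2
    omega
  rcases hu 1 with hu1 | hu1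
  · have hle := half_add_le_tsum_of_digits_eq_one (x := fun k => 1 - (u (k + 1) : ℝ))
      (fun k => sub_nonneg.2 (h1 k)) (fun k => sub_le_self _ (h0 k)) hj hjn
      (by simp [hu1]) (by simp [heq, hu1])
    rw [tsum_one_sub_mul_inv_two_pow_succ h0 h1] at hle
    rw [abs_sub_comm]
    exact le_trans (by linarith) (le_abs_self _)
  · have hle := half_add_le_tsum_of_digits_eq_one h0 h1 hj hjn (by simp [hu1])
      (by simp [heq, hu1])
    exact le_trans (by linarith) (le_abs_self _)
end

section
/- Let f_Tent : [0,1] → [0,1] be the tent map, f_Tent(z) = 1 − |2z − 1|. For a binary sequence u ∈ {0,1}^ℕ define M_Tent(u) = 1/2 + (1/4)·Σ_{l=1}^∞ (−1/2)^{l−1} · Π_{m=1}^{l} (2 u_m − 1). Then for every u ∈ {0,1}^ℕ, f_Tent( M_Tent(u) ) = M_Tent(Tu), where (Tu)_k = u_{k+1} is the left shift of u. -/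
/-- The tent map on `[0,1]`. -/
noncomputable def fTent : ℝ → ℝ := fun z => 1 - |2 * z - 1|

/-- The Gray mapping of binary sequences (indexed from 1) to chaotic samples of the
tent map: `M_Tent(u) = 1/2 + (1/4)·Σ_{l≥1} (−1/2)^{l−1} Π_{m=1}^{l} (2u_m − 1)`. -/
noncomputable def MTent (u : ℕ → ℕ) : ℝ :=
  1 / 2 + (1 / 4) *
    ∑' l : ℕ, (-(1/2) : ℝ) ^ l * ∏ m ∈ Finset.Icc 1 (l + 1), (2 * (u m : ℝ) - 1)

/-- The series in the Gray mapping of a sequence of signs converges absolutely. -/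
theorem summable_abs_graySeries (s : ℕ → ℝ) (hs : ∀ k, |s k| = 1) :
    Summable fun l : ℕ => |(-(1/2) : ℝ) ^ l * ∏ m ∈ Finset.Icc 1 (l + 1), s m| := by
  simpa [abs_mul, Finset.abs_prod, hs, abs_pow] using summable_geometric_two

theorem abs_tsum_graySeries_le_two (s : ℕ → ℝ) (hs : ∀ k, |s k| = 1) :
    |∑' l : ℕ, (-(1/2) : ℝ) ^ l * ∏ m ∈ Finset.Icc 1 (l + 1), s m| ≤ 2 := by
  rw [← Real.norm_eq_abs]
  refine tsum_of_norm_bounded hasSum_geometric_two fun l => ?_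
  simp [hs]

/-- Splitting off the first sign of the series in the Gray mapping. -/
theorem tsum_graySeries_eq_mul_shift (s : ℕ → ℝ) (hs : ∀ k, |s k| = 1) :
    ∑' l : ℕ, (-(1/2) : ℝ) ^ l * ∏ m ∈ Finset.Icc 1 (l + 1), s m =
      s 1 * (1 - 1 / 2 *
        ∑' l : ℕ, (-(1/2) : ℝ) ^ l * ∏ m ∈ Finset.Icc 1 (l + 1), s (m + 1)) := by
  have hterm (l : ℕ) : (-(1/2) : ℝ) ^ (l + 1) * ∏ m ∈ Finset.Icc 1 (l + 1 + 1), s m =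
      s 1 * (-(1/2)) * ((-(1/2) : ℝ) ^ l * ∏ m ∈ Finset.Icc 1 (l + 1), s (m + 1)) := by
    have hprod : ∏ m ∈ Finset.Icc 1 (l + 1 + 1), s m =
        s 1 * ∏ m ∈ Finset.Icc 1 (l + 1), s (m + 1) := by
      simp only [← Finset.Ico_add_one_right_eq_Icc]
      rw [Finset.prod_eq_prod_Ico_succ_bot (by omega), Finset.prod_Ico_add' s 1 (l + 1 + 1) 1]
    rw [hprod]
    ring
  rw [(summable_abs_graySeries s hs).of_abs.tsum_eq_zero_add]
  simp_rw [hterm]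
  rw [tsum_mul_left]
  simp only [pow_zero, zero_add, Finset.Icc_self, Finset.prod_singleton]
  ring

/-- Causality/shift property of the tent-map mapper: `f_Tent(M_Tent(u)) = M_Tent(Tu)`
where `T` is the left shift. -/
theorem stmt7 (u : ℕ → ℕ) (hu : ∀ k, u k = 0 ∨ u k = 1) :
    fTent (MTent u) = MTent (fun k => u (k + 1)) := by
  have hs (k : ℕ) : |2 * (u k : ℝ) - 1| = 1 := by
    rcases hu k with h | h <;> norm_num [h]
  have hsplit := tsum_graySeries_eq_mul_shift (fun k => 2 * (u k : ℝ) - 1) hs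
  have hbound := abs_tsum_graySeries_le_two (fun k => 2 * (u (k + 1) : ℝ) - 1)
    fun k => hs (k + 1)
  simp only [fTent, MTent]
  rw [hsplit]
  set S := ∑' l : ℕ, (-(1/2) : ℝ) ^ l *
    ∏ m ∈ Finset.Icc 1 (l + 1), (2 * (u (m + 1) : ℝ) - 1)
  have hfactor : 2 * (1 / 2 + 1 / 4 * ((2 * (u 1 : ℝ) - 1) * (1 - 1 / 2 * S))) - 1 =
      (2 * (u 1 : ℝ) - 1) * (1 / 2 * (1 - 1 / 2 * S)) := by ring
  rw [hfactor, abs_mul, hs, abs_of_nonneg (by linarith [(abs_le.mp hbound).2])]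
  ring
end

section
/- For a binary sequence u ∈ {0,1}^ℕ define M_Tent(u) = 1/2 + (1/4)·Σ_{l=1}^∞ (−1/2)^{l−1} · Π_{m=1}^{l} (2 u_m − 1), and let ū be the bitwise complement of u (ū_m = 1 − u_m). Then for every u ∈ {0,1}^ℕ, M_Tent(u) − M_Tent(ū) = (1/2)·Σ_{k=1}^∞ 4^{−(k−1)} · Π_{m=1}^{2k−1} (2 u_m − 1), and | M_Tent(u) − M_Tent(ū) | ≥ 1/3. -/
/-- The factors `2u_m − 1` of a binary sequence have products of absolute value `1`. -/
lemma abs_prod_two_mul_sub_one (u : ℕ → ℕ) (hu : ∀ k, u k = 0 ∨ u k = 1) (s : Finset ℕ) :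
    |∏ m ∈ s, (2 * (u m : ℝ) - 1)| = 1 := by
  rw [Finset.abs_prod]
  refine Finset.prod_eq_one fun m _ => ?_
  rcases hu m with h | h <;> norm_num [h]

/-- Complementing a binary sequence flips the sign of every factor `2u_m − 1`. -/
lemma prod_two_mul_compl_sub_one (u : ℕ → ℕ) (hu : ∀ k, u k = 0 ∨ u k = 1) (s : Finset ℕ) :
    ∏ m ∈ s, (2 * ((1 - u m : ℕ) : ℝ) - 1) =
      (-1) ^ s.card * ∏ m ∈ s, (2 * (u m : ℝ) - 1) := by
  rw [← Finset.prod_const, ← Finset.prod_mul_distrib]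
  refine Finset.prod_congr rfl fun m _ => ?_
  rcases hu m with h | h <;> norm_num [h]

/-- A geometric series whose terms are multiplied by signs converges. -/
lemma summable_pow_mul_of_abs_eq_one {r : ℝ} (hr : |r| < 1) {a : ℕ → ℝ}
    (ha : ∀ n, |a n| = 1) : Summable fun n => r ^ n * a n := by
  refine Summable.of_norm ?_
  simpa [ha] using summable_geometric_of_lt_one (abs_nonneg r) hr

lemma tsum_eq_tsum_even_of_odd_eq_zero {f : ℕ → ℝ} (hf : Summable f)
    (hodd : ∀ k, f (2 * k + 1) = 0) : ∑' k, f k = ∑' k, f (2 * k) := by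
  have heven : Summable fun k => f (2 * k) :=
    hf.comp_injective (mul_right_injective₀ (two_ne_zero' ℕ))
  have hzero : Summable fun k => f (2 * k + 1) := by simp [hodd]
  rw [← tsum_even_add_odd heven hzero]
  simp [hodd]

lemma MTent_sub_MTent_compl (u : ℕ → ℕ) (hu : ∀ k, u k = 0 ∨ u k = 1) :
    MTent u - MTent (fun m => 1 - u m) =
      (1 / 2) * ∑' k : ℕ,
        (4:ℝ)⁻¹ ^ k * ∏ m ∈ Finset.Icc 1 (2 * k + 1), (2 * (u m : ℝ) - 1) := by
  have hv : ∀ k, 1 - u k = 0 ∨ 1 - u k = 1 := fun k => by have := hu k; omega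
  have hr : |(-(1 / 2) : ℝ)| < 1 := by norm_num [abs_lt]
  have hsu := summable_pow_mul_of_abs_eq_one hr
    fun l => abs_prod_two_mul_sub_one u hu (Finset.Icc 1 (l + 1))
  have hsv := summable_pow_mul_of_abs_eq_one hr
    fun l => abs_prod_two_mul_sub_one (fun m => 1 - u m) hv (Finset.Icc 1 (l + 1))
  have hE (k : ℕ) : (-(1 / 2) : ℝ) ^ (2 * k) *
        ∏ m ∈ Finset.Icc 1 (2 * k + 1), (2 * (u m : ℝ) - 1) -
      (-(1 / 2) : ℝ) ^ (2 * k) *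
        ∏ m ∈ Finset.Icc 1 (2 * k + 1), (2 * ((1 - u m : ℕ) : ℝ) - 1) =
      2 * ((4:ℝ)⁻¹ ^ k * ∏ m ∈ Finset.Icc 1 (2 * k + 1), (2 * (u m : ℝ) - 1)) := by
    rw [prod_two_mul_compl_sub_one u hu, Nat.card_Icc, Nat.add_sub_cancel, pow_succ, pow_mul,
      pow_mul]
    norm_num
    ring
  have hO (k : ℕ) : (-(1 / 2) : ℝ) ^ (2 * k + 1) *
        ∏ m ∈ Finset.Icc 1 (2 * k + 1 + 1), (2 * (u m : ℝ) - 1) -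
      (-(1 / 2) : ℝ) ^ (2 * k + 1) *
        ∏ m ∈ Finset.Icc 1 (2 * k + 1 + 1), (2 * ((1 - u m : ℕ) : ℝ) - 1) = 0 := by
    rw [prod_two_mul_compl_sub_one u hu, Nat.card_Icc, Nat.add_sub_cancel,
      Even.neg_one_pow (by simp [parity_simps]), one_mul, sub_self]
  have hsub := tsum_eq_tsum_even_of_odd_eq_zero (hsu.sub hsv) hO
  rw [hsu.tsum_sub hsv, tsum_congr hE, tsum_mul_left] at hsub
  unfold MTent
  linarith

/-- A signed geometric series of ratio `1/4` stays away from zero by `2/3`. -/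
lemma two_thirds_le_abs_tsum_inv_four_pow_mul {a : ℕ → ℝ} (ha : ∀ n, |a n| = 1) :
    2 / 3 ≤ |∑' k : ℕ, (4:ℝ)⁻¹ ^ k * a k| := by
  have hs : Summable fun k => (4:ℝ)⁻¹ ^ k * a k :=
    summable_pow_mul_of_abs_eq_one (by norm_num [abs_lt]) ha
  have hgeom : HasSum (fun k : ℕ => (4:ℝ)⁻¹ * (4:ℝ)⁻¹ ^ k) (1 / 3) := by
    have h := (hasSum_geometric_of_lt_one (r := (4:ℝ)⁻¹) (by norm_num) (by norm_num)).mul_left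
      (4:ℝ)⁻¹
    rwa [show (4:ℝ)⁻¹ * (1 - 4⁻¹)⁻¹ = 1 / 3 by norm_num] at h
  have htail : |∑' k : ℕ, (4:ℝ)⁻¹ ^ (k + 1) * a (k + 1)| ≤ 1 / 3 := by
    rw [← Real.norm_eq_abs]
    exact tsum_of_norm_bounded hgeom fun k => by simp [ha, pow_succ, mul_comm]
  rw [hs.tsum_eq_zero_add, pow_zero, one_mul]
  have h := abs_sub_abs_le_abs_sub (a 0) (-∑' k : ℕ, (4:ℝ)⁻¹ ^ (k + 1) * a (k + 1))
  rw [abs_neg, sub_neg_eq_add, ha] at h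
  linarith

/-- Core estimate for adaptive-bandwidth tent-map CCM: for complementary symbolic
sequences only the odd-length product terms survive in `M_Tent(u) − M_Tent(ū)`,
and the two mapped points are always at distance at least `1/3`. -/
theorem stmt10 (u : ℕ → ℕ) (hu : ∀ k, u k = 0 ∨ u k = 1) :
    (MTent u - MTent (fun m => 1 - u m) =
      (1 / 2) * ∑' k : ℕ,
        (4:ℝ)⁻¹ ^ k * ∏ m ∈ Finset.Icc 1 (2 * k + 1), (2 * (u m : ℝ) - 1)) ∧
    1 / 3 ≤ |MTent u - MTent (fun m => 1 - u m)| := by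
  have h := MTent_sub_MTent_compl u hu
  refine ⟨h, ?_⟩
  have hbound := two_thirds_le_abs_tsum_inv_four_pow_mul
    fun k => abs_prod_two_mul_sub_one u hu (Finset.Icc 1 (2 * k + 1))
  rw [h, abs_mul, abs_of_pos (by norm_num : (0:ℝ) < 1 / 2)]
  linarith
end

section
/- For a binary sequence u ∈ {0,1}^ℕ define M_Tent(u) = 1/2 + (1/4)·Σ_{l=1}^∞ (−1/2)^{l−1} · Π_{m=1}^{l} (2 u_m − 1), and let ū be the bitwise complement of u. Then for every strictly increasing function g : [0,1] → [0,1] and every u ∈ {0,1}^ℕ, ( g(M_Tent(u)) − g(M_Tent(ū)) )² ≥ inf_{x ∈ [1/6, 1/2]} ( g(x) − g(x + 1/3) )². -/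
/-- Partial products of the signs `2 u_m - 1` attached to a binary sequence. -/
noncomputable def signProd (u : ℕ → ℕ) (l : ℕ) : ℝ :=
  ∏ m ∈ Finset.Icc 1 (l + 1), (2 * (u m : ℝ) - 1)

lemma abs_signProd {u : ℕ → ℕ} (hu : ∀ k, u k = 0 ∨ u k = 1) (l : ℕ) :
    |signProd u l| = 1 := by
  rw [signProd, Finset.abs_prod]
  refine Finset.prod_eq_one fun m _ => ?_
  rcases hu m with h | h <;> norm_num [h]

lemma signProd_complement {u : ℕ → ℕ} (hu : ∀ k, u k = 0 ∨ u k = 1) (l : ℕ) :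
    signProd (fun m => 1 - u m) l = (-1) ^ (l + 1) * signProd u l := by
  have h : ∀ m ∈ Finset.Icc 1 (l + 1),
      2 * ((1 - u m : ℕ) : ℝ) - 1 = (-1) * (2 * (u m : ℝ) - 1) := by
    intro m _
    rcases hu m with h | h <;> norm_num [h]
  rw [signProd, Finset.prod_congr rfl h, Finset.prod_mul_distrib]
  simp [signProd]

lemma summable_geometric_mul_of_abs_le_one {r : ℝ} (hr₀ : 0 ≤ r) (hr₁ : r < 1) {s : ℕ → ℝ}
    (hs : ∀ k, |s k| ≤ 1) : Summable fun k => r ^ k * s k := by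
  refine Summable.of_norm_bounded (summable_geometric_of_lt_one hr₀ hr₁) fun k => ?_
  rw [Real.norm_eq_abs, abs_mul, abs_of_nonneg (pow_nonneg hr₀ k)]
  exact mul_le_of_le_one_right (pow_nonneg hr₀ k) (hs k)

lemma abs_tsum_geometric_mul_le {r : ℝ} (hr₀ : 0 ≤ r) (hr₁ : r < 1) {s : ℕ → ℝ}
    (hs : ∀ k, |s k| ≤ 1) : |∑' k, r ^ k * s k| ≤ (1 - r)⁻¹ := by
  refine tsum_of_norm_bounded (f := fun k => r ^ k * s k)
    (hasSum_geometric_of_lt_one hr₀ hr₁) fun k => ?_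
  rw [Real.norm_eq_abs, abs_mul, abs_of_nonneg (pow_nonneg hr₀ k)]
  exact mul_le_of_le_one_right (pow_nonneg hr₀ k) (hs k)

lemma abs_tsum_geometric_mul_sub_le {r : ℝ} (hr₀ : 0 ≤ r) (hr₁ : r < 1) {s : ℕ → ℝ}
    (hs : ∀ k, |s k| ≤ 1) : |∑' k, r ^ k * s k - s 0| ≤ r * (1 - r)⁻¹ := by
  have h : ∑' k, r ^ k * s k - s 0 = r * ∑' k, r ^ k * s (k + 1) := by
    rw [(summable_geometric_mul_of_abs_le_one hr₀ hr₁ hs).tsum_eq_zero_add, ← tsum_mul_left]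
    simp [pow_succ', mul_assoc]
  rw [h, abs_mul, abs_of_nonneg hr₀]
  exact mul_le_mul_of_nonneg_left
    (abs_tsum_geometric_mul_le hr₀ hr₁ fun k => hs (k + 1)) hr₀

/-- The even- and odd-indexed parts of the series defining `MTent`. -/
lemma tsum_neg_half_pow_mul {s : ℕ → ℝ} (hs : ∀ k, |s k| ≤ 1) :
    ∑' l, (-(1/2) : ℝ) ^ l * s l =
      ∑' k, (1/4 : ℝ) ^ k * s (2 * k) - 1/2 * ∑' k, (1/4 : ℝ) ^ k * s (2 * k + 1) := by
  have he : ∀ k, (-(1/2) : ℝ) ^ (2 * k) * s (2 * k) = (1/4) ^ k * s (2 * k) := by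
    intro k
    rw [pow_mul]
    norm_num
  have ho : ∀ k, (-(1/2) : ℝ) ^ (2 * k + 1) * s (2 * k + 1) =
      -(1/2) * ((1/4) ^ k * s (2 * k + 1)) := by
    intro k
    rw [pow_succ, pow_mul]
    norm_num
    ring
  have hse := summable_geometric_mul_of_abs_le_one (r := 1/4) (by norm_num) (by norm_num)
    fun k => hs (2 * k)
  have hso := summable_geometric_mul_of_abs_le_one (r := 1/4) (by norm_num) (by norm_num)
    fun k => hs (2 * k + 1)
  rw [← tsum_even_add_odd (f := fun l => (-(1/2) : ℝ) ^ l * s l)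
    (hse.congr fun k => (he k).symm) ((hso.mul_left _).congr fun k => (ho k).symm)]
  simp only [he, ho, tsum_mul_left]
  ring

/-- The two points attached to complementary sequences have difference `e / 2` and sum `1 - o / 2`,
where `e` is at distance at most `1/3` from a sign and `|o| ≤ 2/3`. -/
lemma exists_MTent_eq {u : ℕ → ℕ} (hu : ∀ k, u k = 0 ∨ u k = 1) :
    ∃ e o : ℝ, MTent u = 1/2 + 1/4 * (e - o) ∧
      MTent (fun m => 1 - u m) = 1/2 - 1/4 * (e + o) ∧
      |o| ≤ 2/3 ∧ (|e - 1| ≤ 1/3 ∨ |e + 1| ≤ 1/3) := by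
  have hs : ∀ k, |signProd u k| ≤ 1 := fun k => (abs_signProd hu k).le
  have hū : ∀ k, (1 - u k) = 0 ∨ (1 - u k) = 1 := fun k => by omega
  have hs' : ∀ k, |signProd (fun m => 1 - u m) k| ≤ 1 := fun k => (abs_signProd hū k).le
  refine ⟨∑' k, (1/4 : ℝ) ^ k * signProd u (2 * k),
    1/2 * ∑' k, (1/4 : ℝ) ^ k * signProd u (2 * k + 1), ?_, ?_, ?_, ?_⟩
  · rw [← tsum_neg_half_pow_mul hs]
    rfl
  · change 1/2 + 1/4 * ∑' l, (-(1/2) : ℝ) ^ l * signProd (fun m => 1 - u m) l = _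
    have he : ∀ k, (-1 : ℝ) ^ (2 * k + 1) = -1 := fun k => by simp [pow_succ]
    have ho : ∀ k, (-1 : ℝ) ^ (2 * k + 1 + 1) = 1 := fun k => by simp [pow_succ]
    rw [tsum_neg_half_pow_mul hs']
    simp only [signProd_complement hu, he, ho, one_mul, neg_mul, mul_neg, tsum_neg]
    ring
  · have h := abs_tsum_geometric_mul_le (r := 1/4) (by norm_num) (by norm_num)
      fun k => hs (2 * k + 1)
    rw [abs_mul, abs_of_pos (by norm_num : (0 : ℝ) < 1/2)]
    norm_num at h ⊢
    linarith
  · have h := abs_tsum_geometric_mul_sub_le (r := 1/4) (by norm_num) (by norm_num)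
      fun k => hs (2 * k)
    have h3 : (1/4 : ℝ) * (1 - 1/4)⁻¹ = 1/3 := by norm_num
    rw [h3, mul_zero] at h
    rcases eq_or_eq_neg_of_abs_eq (abs_signProd hu 0) with h0 | h0
    · exact Or.inl (by rwa [h0] at h)
    · exact Or.inr (by rwa [h0, sub_neg_eq_add] at h)

lemma sInf_sq_increment_le {g : ℝ → ℝ} (hg : MonotoneOn g (Set.Icc 0 1)) {a b : ℝ}
    (ha : 0 ≤ a) (hb : b ≤ 1) (hab : a + 1/3 ≤ b) (ha' : a ≤ 1/2) (hb' : 1/2 ≤ b) :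
    sInf ((fun x : ℝ => (g x - g (x + 1/3)) ^ 2) '' Set.Icc (1/6) (1/2)) ≤
      (g b - g a) ^ 2 := by
  have hbdd : BddBelow ((fun x : ℝ => (g x - g (x + 1/3)) ^ 2) '' Set.Icc (1/6) (1/2)) := by
    refine ⟨0, ?_⟩
    rintro _ ⟨x, -, rfl⟩
    exact sq_nonneg _
  obtain ⟨x, hx, hax, hxb⟩ : ∃ x ∈ Set.Icc (1/6 : ℝ) (1/2), a ≤ x ∧ x + 1/3 ≤ b := by
    refine ⟨max a (1/6), ⟨le_max_right _ _, max_le ha' (by norm_num)⟩, le_max_left _ _, ?_⟩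
    rcases max_cases a (1/6) with h | h <;> linarith
  refine (csInf_le hbdd ⟨x, hx, rfl⟩).trans ?_
  have h₁ : g a ≤ g x := hg ⟨ha, by linarith⟩ ⟨by linarith, by linarith⟩ hax
  have h₂ : g x ≤ g (x + 1/3) :=
    hg ⟨by linarith, by linarith⟩ ⟨by linarith, by linarith⟩ (by linarith)
  have h₃ : g (x + 1/3) ≤ g b := hg ⟨by linarith, by linarith⟩ ⟨by linarith, hb⟩ hxb
  change (g x - g (x + 1/3)) ^ 2 ≤ _
  rw [sub_sq_comm (g x)]
  exact pow_le_pow_left₀ (by linarith) (by linarith) 2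

/-- Per-step distance bound for adaptive-bandwidth CCM built on maps conjugate to the
tent map via a strictly increasing conjugation `g : [0,1] → [0,1]`: for complementary
symbolic sequences, `(g(M_Tent(u)) − g(M_Tent(ū)))²` is at least the infimum of
`(g(x) − g(x + 1/3))²` over `x ∈ [1/6, 1/2]`. -/
theorem stmt11 (g : ℝ → ℝ) (hmono : StrictMonoOn g (Set.Icc 0 1))
    (hmaps : Set.MapsTo g (Set.Icc 0 1) (Set.Icc 0 1))
    (u : ℕ → ℕ) (hu : ∀ k, u k = 0 ∨ u k = 1) :
    sInf ((fun x : ℝ => (g x - g (x + 1/3)) ^ 2) '' Set.Icc (1/6) (1/2)) ≤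
      (g (MTent u) - g (MTent (fun m => 1 - u m))) ^ 2 := by
  obtain ⟨e, o, h₁, h₂, ho, he⟩ := exists_MTent_eq hu
  rw [abs_le] at ho
  rcases he with he | he <;> rw [abs_le] at he
  · apply sInf_sq_increment_le hmono.monotoneOn <;> linarith
  · rw [sub_sq_comm (g (MTent u))]
    apply sInf_sq_increment_le hmono.monotoneOn <;> linarith
end

section
/- Let f_Tent : [0,1] → [0,1] be the tent map, f_Tent(z) = 1 − |2z − 1|, and for u ∈ {0,1}^ℕ let M_Tent(u) = 1/2 + (1/4)·Σ_{l=1}^∞ (−1/2)^{l−1} · Π_{m=1}^{l} (2 u_m − 1), with ū the bitwise complement of u. Then for every u ∈ {0,1}^ℕ and every integer d ≥ 1, Σ_{j=1}^{d} ( f_Tent^{(j)}(M_Tent(u)) − f_Tent^{(j)}(M_Tent(ū)) )² ≥ d/9, where f_Tent^{(j)} denotes the j-fold iterate of f_Tent. -/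
/-- The series `Σ_{l≥0} (−1/2)^l Π_{m=1}^{l+1} a_m` of a sequence of signs. -/
noncomputable def signSeries (a : ℕ → ℝ) : ℝ :=
  ∑' l : ℕ, (-(1/2) : ℝ) ^ l * ∏ m ∈ Finset.Icc 1 (l + 1), a m

theorem abs_prod_signs {a : ℕ → ℝ} (ha : ∀ m, |a m| = 1) (s : Finset ℕ) :
    |∏ m ∈ s, a m| = 1 := by
  simp [Finset.abs_prod, ha]

theorem abs_signSeries_term {a : ℕ → ℝ} (ha : ∀ m, |a m| = 1) (l : ℕ) :
    |(-(1/2) : ℝ) ^ l * ∏ m ∈ Finset.Icc 1 (l + 1), a m| = (1 / 2 : ℝ) ^ l := by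
  rw [abs_mul, abs_prod_signs ha, abs_pow, abs_neg, mul_one, abs_of_pos (by norm_num)]

theorem summable_signSeries {a : ℕ → ℝ} (ha : ∀ m, |a m| = 1) :
    Summable fun l : ℕ => (-(1/2) : ℝ) ^ l * ∏ m ∈ Finset.Icc 1 (l + 1), a m :=
  Summable.of_norm_bounded hasSum_geometric_two.summable fun l => (abs_signSeries_term ha l).le

theorem abs_signSeries_le {a : ℕ → ℝ} (ha : ∀ m, |a m| = 1) : |signSeries a| ≤ 2 := by
  rw [← Real.norm_eq_abs]
  exact tsum_of_norm_bounded hasSum_geometric_two fun l => (abs_signSeries_term ha l).le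

theorem prod_Icc_one_succ (a : ℕ → ℝ) (n : ℕ) :
    ∏ m ∈ Finset.Icc 1 (n + 1), a m = a 1 * ∏ m ∈ Finset.Icc 1 n, a (m + 1) := by
  induction n with
  | zero => simp
  | succ n ih =>
    rw [Finset.prod_Icc_succ_top (by omega), ih, Finset.prod_Icc_succ_top (by omega), mul_assoc]

theorem signSeries_eq_shift {a : ℕ → ℝ} (ha : ∀ m, |a m| = 1) :
    signSeries a = a 1 * (1 - signSeries (fun m => a (m + 1)) / 2) := by
  have h : ∀ l : ℕ, (-(1/2) : ℝ) ^ (l + 1) * ∏ m ∈ Finset.Icc 1 (l + 1 + 1), a m =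
      (-(1/2) * a 1) * ((-(1/2) : ℝ) ^ l * ∏ m ∈ Finset.Icc 1 (l + 1), a (m + 1)) := by
    intro l
    rw [prod_Icc_one_succ]
    ring
  rw [signSeries, (summable_signSeries ha).tsum_eq_zero_add, tsum_congr h, tsum_mul_left,
    signSeries]
  simp only [pow_zero, zero_add, Finset.Icc_self, Finset.prod_singleton]
  ring

theorem abs_signSeries_sub_neg_ge {a : ℕ → ℝ} (ha : ∀ m, |a m| = 1) :
    4 / 3 ≤ |signSeries a - signSeries fun m => -a m| := by
  have hneg : ∀ m, |-a m| = 1 := fun m => by rw [abs_neg, ha]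
  have hterm : ∀ l : ℕ, (-(1/2) : ℝ) ^ l * ∏ m ∈ Finset.Icc 1 (l + 1), a m -
      (-(1/2) : ℝ) ^ l * ∏ m ∈ Finset.Icc 1 (l + 1), -a m =
      ((-(1/2) : ℝ) ^ l + (1 / 2) ^ l) * ∏ m ∈ Finset.Icc 1 (l + 1), a m := by
    intro l
    have hsign : (-(1/2) : ℝ) ^ l * (-1) ^ l = (1 / 2) ^ l := by
      rw [← mul_pow]
      norm_num
    rw [Finset.prod_neg, Nat.card_Icc, Nat.add_sub_cancel, ← hsign]
    ring
  have hsum := (summable_signSeries ha).sub (summable_signSeries hneg)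
  have hbound : HasSum (fun l : ℕ => (-(1/2) : ℝ) ^ (l + 1) + (1 / 2) ^ (l + 1)) (2 / 3) := by
    have h := (hasSum_geometric_of_abs_lt_one (r := (-(1/2) : ℝ))
      (by rw [abs_neg, abs_of_pos] <;> norm_num)).add hasSum_geometric_two
    rw [← hasSum_nat_add_iff' 1] at h
    have hval : (1 - -(1/2) : ℝ)⁻¹ + 2 -
        ∑ i ∈ Finset.range 1, ((-(1/2) : ℝ) ^ i + (1 / 2) ^ i) = 2 / 3 := by
      norm_num
    rwa [hval] at h
  have htail : |∑' l : ℕ, ((-(1/2) : ℝ) ^ (l + 1) + (1 / 2) ^ (l + 1)) *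
      ∏ m ∈ Finset.Icc 1 (l + 1 + 1), a m| ≤ 2 / 3 := by
    rw [← Real.norm_eq_abs]
    refine tsum_of_norm_bounded hbound fun l => ?_
    rw [Real.norm_eq_abs, abs_mul, abs_prod_signs ha, mul_one, abs_of_nonneg]
    have h := neg_abs_le ((-(1/2) : ℝ) ^ (l + 1))
    rw [abs_pow, abs_neg, abs_of_pos (by norm_num : (0 : ℝ) < 1 / 2)] at h
    linarith
  have hsplit : signSeries a - signSeries (fun m => -a m) =
      2 * a 1 + ∑' l : ℕ, ((-(1/2) : ℝ) ^ (l + 1) + (1 / 2) ^ (l + 1)) *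
        ∏ m ∈ Finset.Icc 1 (l + 1 + 1), a m := by
    rw [signSeries, signSeries, ← (summable_signSeries ha).tsum_sub (summable_signSeries hneg),
      hsum.tsum_eq_zero_add, tsum_congr fun l => hterm (l + 1), hterm 0]
    simp only [pow_zero, zero_add, Finset.Icc_self, Finset.prod_singleton]
    ring
  rw [hsplit]
  have h := abs_sub_abs_le_abs_add (2 * a 1) (∑' l : ℕ, ((-(1/2) : ℝ) ^ (l + 1) +
    (1 / 2) ^ (l + 1)) * ∏ m ∈ Finset.Icc 1 (l + 1 + 1), a m)
  rw [abs_mul, ha, abs_two] at h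
  linarith

theorem MTent_eq_signSeries (u : ℕ → ℕ) :
    MTent u = 1 / 2 + 1 / 4 * signSeries fun m => 2 * (u m : ℝ) - 1 :=
  rfl

theorem abs_two_mul_sub_one {u : ℕ → ℕ} (hu : ∀ k, u k = 0 ∨ u k = 1) (m : ℕ) :
    |2 * (u m : ℝ) - 1| = 1 := by
  rcases hu m with h | h <;> norm_num [h]

/-- The tent map acts on symbolic sequences as the shift. -/
theorem fTent_MTent {u : ℕ → ℕ} (hu : ∀ k, u k = 0 ∨ u k = 1) :
    fTent (MTent u) = MTent fun m => u (m + 1) := by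
  have ha := abs_two_mul_sub_one hu
  have hle := (abs_le.1 (abs_signSeries_le fun m => ha (m + 1))).2
  rw [MTent_eq_signSeries, MTent_eq_signSeries, fTent, signSeries_eq_shift ha]
  set t := signSeries fun m => 2 * (u (m + 1) : ℝ) - 1
  have harg : 2 * (1 / 2 + 1 / 4 * ((2 * (u 1 : ℝ) - 1) * (1 - t / 2))) - 1 =
      (2 * (u 1 : ℝ) - 1) * ((1 - t / 2) / 2) := by
    ring
  rw [harg, abs_mul, ha, abs_of_nonneg (by linarith)]
  ring

theorem fTent_iterate_MTent {u : ℕ → ℕ} (hu : ∀ k, u k = 0 ∨ u k = 1) (j : ℕ) :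
    fTent^[j] (MTent u) = MTent fun m => u (m + j) := by
  induction j with
  | zero => rfl
  | succ j ih =>
    rw [Function.iterate_succ_apply', ih, fTent_MTent fun k => hu (k + j)]
    simp only [add_right_comm _ 1 j, add_assoc]

/-- Complementary sequences have images at distance at least `1/3`. -/
theorem abs_MTent_sub_compl_ge {v : ℕ → ℕ} (hv : ∀ k, v k = 0 ∨ v k = 1) :
    1 / 3 ≤ |MTent v - MTent fun m => 1 - v m| := by
  have hcompl : (fun m => 2 * ((1 - v m : ℕ) : ℝ) - 1) = fun m => -(2 * (v m : ℝ) - 1) := by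
    funext m
    rcases hv m with h | h <;> norm_num [h]
  have h := abs_signSeries_sub_neg_ge (abs_two_mul_sub_one hv)
  rw [MTent_eq_signSeries, MTent_eq_signSeries, hcompl, add_sub_add_left_eq_sub, ← mul_sub,
    abs_mul, abs_of_pos (by norm_num)]
  linarith

/-- Anytime-reliability proposition for adaptive-bandwidth CCM with the tent map:
for complementary initial symbolic sequences, the squared Euclidean distance between
the two chaotic trajectories after `d` steps is at least `d/9`. -/
theorem stmt12 (u : ℕ → ℕ) (hu : ∀ k, u k = 0 ∨ u k = 1) (d : ℕ) (hd : 1 ≤ d) :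
    (d : ℝ) / 9 ≤
      ∑ j ∈ Finset.Icc 1 d,
        (fTent^[j] (MTent u) - fTent^[j] (MTent (fun m => 1 - u m))) ^ 2 := by
  have hu' : ∀ k, 1 - u k = 0 ∨ 1 - u k = 1 := fun k => by
    have := hu k
    omega
  have hterm : ∀ j ∈ Finset.Icc 1 d, (1 / 9 : ℝ) ≤
      (fTent^[j] (MTent u) - fTent^[j] (MTent (fun m => 1 - u m))) ^ 2 := by
    intro j _
    rw [fTent_iterate_MTent hu, fTent_iterate_MTent hu', ← sq_abs]
    have h := abs_MTent_sub_compl_ge fun k => hu (k + j)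
    calc (1 / 9 : ℝ) = (1 / 3) ^ 2 := by norm_num
      _ ≤ _ := pow_le_pow_left₀ (by norm_num) h 2
  have h := Finset.card_nsmul_le_sum _ _ _ hterm
  rw [Nat.card_Icc, Nat.add_sub_cancel, nsmul_eq_mul, mul_one_div] at h
  exact h
end

section
/- Let g : [0,1] → [0,1] be a strictly increasing function, let m_r ≥ 1 be an integer, and let u ∈ {0,1}^ℕ contain no run of more than m_r consecutive equal bits (no index i with u_i = u_{i+1} = ⋯ = u_{i+m_r}); let ū be the bitwise complement of u and let T denote the left shift, (T^j u)_k = u_{j+k}. Then for every integer j ≥ 0, ( g( Σ_{k=1}^∞ u_{j+k} 2^{−k} ) − g( Σ_{k=1}^∞ ū_{j+k} 2^{−k} ) )² ≥ β, where β = ( g(1/2 − 2^{−(m_r+2)}) − g(1/2 + 2^{−(m_r+2)}) )² > 0; consequently Σ_{j=1}^{d} ( g(M_BSM(T^j u)) − g(M_BSM(T^j ū)) )² ≥ β·d for every d ≥ 1, where M_BSM(v) = Σ_{k=1}^∞ v_k 2^{−k}. -/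
/-- The BSM mapper applied to the `j`-fold left shift of the sequence `v`
(sequences are indexed from 1): `M_BSM(Tʲv) = Σ_{k≥1} v_{j+k} 2^{−k}`. -/
noncomputable def MBSMshift (v : ℕ → ℕ) (j : ℕ) : ℝ :=
  ∑' k : ℕ, (v (j + k + 1) : ℝ) * (2:ℝ)⁻¹ ^ (k + 1)

/-- The defining series of `MBSMshift` converges for binary sequences. -/
theorem summable_MBSMshift {v : ℕ → ℕ} (hv : ∀ k, v k ≤ 1) (j : ℕ) :
    Summable fun k : ℕ => (v (j + k + 1) : ℝ) * (2:ℝ)⁻¹ ^ (k + 1) := by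
  have hgeom : Summable fun k : ℕ => (2:ℝ)⁻¹ ^ (k + 1) :=
    (summable_nat_add_iff 1).2 (summable_geometric_of_lt_one (by norm_num) (by norm_num))
  refine hgeom.of_nonneg_of_le (fun k => by positivity) fun k => ?_
  have h : (v (j + k + 1) : ℝ) ≤ 1 := by exact_mod_cast hv _
  exact mul_le_of_le_one_left (by positivity) h

theorem MBSMshift_nonneg (v : ℕ → ℕ) (j : ℕ) : 0 ≤ MBSMshift v j :=
  tsum_nonneg fun k => by positivity

/-- The mapped points of a binary sequence and of its complement are symmetric about `1/2`. -/
theorem MBSMshift_add_compl {v : ℕ → ℕ} (hv : ∀ k, v k ≤ 1) (j : ℕ) :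
    MBSMshift v j + MBSMshift (fun m => 1 - v m) j = 1 := by
  unfold MBSMshift
  rw [← (summable_MBSMshift hv j).tsum_add
    (summable_MBSMshift (v := fun m => 1 - v m) (fun k => Nat.sub_le _ _) j)]
  have hterm : ∀ k : ℕ, (v (j + k + 1) : ℝ) * (2:ℝ)⁻¹ ^ (k + 1) +
      ((1 - v (j + k + 1) : ℕ) : ℝ) * (2:ℝ)⁻¹ ^ (k + 1) = (2:ℝ)⁻¹ ^ k * 2⁻¹ := fun k => by
    rw [Nat.cast_sub (hv _)]
    push_cast
    ring
  simp_rw [hterm]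
  rw [tsum_mul_right, tsum_geometric_of_lt_one (by norm_num) (by norm_num)]
  norm_num

/-- A leading `1` followed by another `1` within the next `n + 1` bits keeps the mapped point
at distance `2^{-(n+2)}` above `1/2`. -/
theorem half_add_le_MBSMshift {v : ℕ → ℕ} (hv : ∀ k, v k ≤ 1) {j n t : ℕ} (ht : t ≤ n)
    (hfirst : v (j + 1) = 1) (hnext : v (j + 2 + t) = 1) :
    1 / 2 + (2:ℝ)⁻¹ ^ (n + 2) ≤ MBSMshift v j := by
  have hsum := (summable_MBSMshift hv j).sum_le_tsum {0, t + 1} (fun k _ => by positivity)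
  rw [Finset.sum_pair (Nat.succ_ne_zero t).symm, show j + (t + 1) + 1 = j + 2 + t by ring,
    show j + 0 + 1 = j + 1 by ring, hfirst, hnext] at hsum
  have hpow : (2:ℝ)⁻¹ ^ (n + 2) ≤ 2⁻¹ ^ (t + 1 + 1) :=
    pow_le_pow_of_le_one (by norm_num) (by norm_num) (by omega)
  unfold MBSMshift
  norm_num at hsum hpow ⊢
  linarith

/-- Two points symmetric about `1/2`, at distance at least `ε` from it, have images under an
increasing `g` that are at least as far apart as those of `1/2 ± ε`. -/
theorem sq_sub_le_of_symmetric {g : ℝ → ℝ} (hg : MonotoneOn g (Set.Icc 0 1)) {x y ε : ℝ}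
    (hε : 0 ≤ ε) (hy : 0 ≤ y) (hxy : x + y = 1) (hx : 1 / 2 + ε ≤ x) :
    (g (1 / 2 - ε) - g (1 / 2 + ε)) ^ 2 ≤ (g x - g y) ^ 2 := by
  have hupper : g (1 / 2 + ε) ≤ g x :=
    hg ⟨by linarith, by linarith⟩ ⟨by linarith, by linarith⟩ hx
  have hlower : g y ≤ g (1 / 2 - ε) :=
    hg ⟨by linarith, by linarith⟩ ⟨by linarith, by linarith⟩ (by linarith)
  have hmid : g (1 / 2 - ε) ≤ g (1 / 2 + ε) :=
    hg ⟨by linarith, by linarith⟩ ⟨by linarith, by linarith⟩ (by linarith)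
  rw [← neg_sub, neg_sq]
  exact pow_le_pow_left₀ (by linarith) (by linarith) 2

/-- Anytime-reliability proposition for adaptive-bandwidth CCM built on maps conjugate
to the BSM via a strictly increasing conjugation `g : [0,1] → [0,1]`: under the
run-length constraint `mr` on the symbolic sequence `u`, with `ū` its bitwise
complement, every pair of shifted mapped points is at squared `g`-distance at least
`β = (g(1/2 − 2^{−(mr+2)}) − g(1/2 + 2^{−(mr+2)}))² > 0`, whence the squared
trajectory distance after `d` steps is at least `β·d`. -/
theorem stmt18 (g : ℝ → ℝ) (hmono : StrictMonoOn g (Set.Icc 0 1))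
    (hmaps : Set.MapsTo g (Set.Icc 0 1) (Set.Icc 0 1))
    (mr : ℕ) (hmr : 1 ≤ mr) (u : ℕ → ℕ) (hu : ∀ k, u k = 0 ∨ u k = 1)
    (hrun : ¬ ∃ i : ℕ, 1 ≤ i ∧ ∀ t ≤ mr, u (i + t) = u i)
    (β : ℝ)
    (hβ : β = (g (1 / 2 - (2:ℝ)⁻¹ ^ (mr + 2)) - g (1 / 2 + (2:ℝ)⁻¹ ^ (mr + 2))) ^ 2) :
    0 < β ∧
    (∀ j : ℕ,
      β ≤ (g (MBSMshift u j) - g (MBSMshift (fun m => 1 - u m) j)) ^ 2) ∧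
    (∀ d : ℕ, 1 ≤ d →
      β * d ≤ ∑ j ∈ Finset.Icc 1 d,
        (g (MBSMshift u j) - g (MBSMshift (fun m => 1 - u m) j)) ^ 2) := by
  have hle : ∀ k, u k ≤ 1 := fun k => by rcases hu k with h | h <;> omega
  have hε : (0:ℝ) < 2⁻¹ ^ (mr + 2) := by positivity
  have hε' : (2:ℝ)⁻¹ ^ (mr + 2) ≤ 1 / 2 := by
    have h := pow_le_pow_of_le_one (by norm_num : (0:ℝ) ≤ 2⁻¹) (by norm_num)
      (by omega : 1 ≤ mr + 2)
    linarith
  have hpoint : ∀ j : ℕ,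
      β ≤ (g (MBSMshift u j) - g (MBSMshift (fun m => 1 - u m) j)) ^ 2 := by
    intro j
    have hsymm := MBSMshift_add_compl hle j
    have hchange : ∀ b ≤ 1, ∃ t ≤ mr, u (j + 2 + t) = b := by
      intro b hb
      by_contra! hne
      refine hrun ⟨j + 2, by omega, fun t ht => ?_⟩
      have h₀ := hne 0 (Nat.zero_le _)
      have h₁ := hne t ht
      have h₂ := hle (j + 2)
      have h₃ := hle (j + 2 + t)
      rw [add_zero] at h₀
      omega
    rw [hβ]
    rcases hu (j + 1) with hfirst | hfirst
    · obtain ⟨t, ht, hnext⟩ := hchange 0 zero_le_one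
      rw [← neg_sub (g (MBSMshift (fun m => 1 - u m) j)), neg_sq]
      refine sq_sub_le_of_symmetric hmono.monotoneOn hε.le (MBSMshift_nonneg _ _)
        (by linarith) (half_add_le_MBSMshift (fun k => Nat.sub_le _ _) ht ?_ ?_)
      · simp [hfirst]
      · simp [hnext]
    · obtain ⟨t, ht, hnext⟩ := hchange 1 le_rfl
      exact sq_sub_le_of_symmetric hmono.monotoneOn hε.le (MBSMshift_nonneg _ _) hsymm
        (half_add_le_MBSMshift hle ht hfirst hnext)
  refine ⟨?_, hpoint, fun d _ => ?_⟩
  · have hlt : g (1 / 2 - (2:ℝ)⁻¹ ^ (mr + 2)) < g (1 / 2 + (2:ℝ)⁻¹ ^ (mr + 2)) :=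
      hmono ⟨by linarith, by linarith⟩ ⟨by linarith, by linarith⟩ (by linarith)
    rw [hβ]
    exact sq_pos_of_neg (by linarith)
  · have h := Finset.card_nsmul_le_sum (Finset.Icc 1 d) _ β fun j _ => hpoint j
    rw [Nat.card_Icc, Nat.add_sub_cancel, nsmul_eq_mul] at h
    rwa [mul_comm]
end

section
/- The infimum over x ∈ [1/6, 1/2] of ( sin²( π(x + 1/3)/2 ) − sin²( π x/2 ) )² equals 3/16, and it is attained at the endpoints x = 1/6 and x = 1/2. -/
/-- The squared increment of `x ↦ sin² (πx/2)` over a step `1/3` in closed form. -/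
theorem sq_sin_sq_sub_sin_sq_eq (x : ℝ) :
    (Real.sin (Real.pi * (x + 1/3) / 2) ^ 2 - Real.sin (Real.pi * x / 2) ^ 2) ^ 2 =
      Real.cos (Real.pi * x - Real.pi / 3) ^ 2 / 4 := by
  have key : Real.sin (Real.pi * (x + 1/3) / 2) ^ 2 - Real.sin (Real.pi * x / 2) ^ 2 =
      Real.cos (Real.pi * x - Real.pi / 3) / 2 := by
    rw [Real.sin_sq_eq_half_sub, Real.sin_sq_eq_half_sub,
      show 2 * (Real.pi * (x + 1/3) / 2) = Real.pi * x + Real.pi / 3 by ring,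
      show 2 * (Real.pi * x / 2) = Real.pi * x by ring, Real.cos_add, Real.cos_sub,
      Real.cos_pi_div_three]
    ring
  rw [key]
  ring

theorem sqrt_three_div_two_le_cos {y : ℝ} (hy : |y| ≤ Real.pi / 6) :
    √3 / 2 ≤ Real.cos y := by
  rw [← Real.cos_pi_div_six, ← Real.cos_abs y]
  exact Real.cos_le_cos_of_nonneg_of_le_pi (abs_nonneg y) (by linarith [Real.pi_pos]) hy

/-- The anytime-reliability constant of logistic-map adaptive-bandwidth CCM:
with `g(x) = sin²(πx/2)`, the infimum over `x ∈ [1/6, 1/2]` of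
`(g(x + 1/3) − g(x))²` equals `3/16`, attained at both endpoints. -/
theorem stmt19 :
    sInf ((fun x : ℝ =>
        (Real.sin (Real.pi * (x + 1/3) / 2) ^ 2 - Real.sin (Real.pi * x / 2) ^ 2) ^ 2) ''
      Set.Icc (1/6) (1/2)) = 3 / 16 ∧
    (Real.sin (Real.pi * ((1:ℝ)/6 + 1/3) / 2) ^ 2 -
        Real.sin (Real.pi * ((1:ℝ)/6) / 2) ^ 2) ^ 2 = 3 / 16 ∧
    (Real.sin (Real.pi * ((1:ℝ)/2 + 1/3) / 2) ^ 2 -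
        Real.sin (Real.pi * ((1:ℝ)/2) / 2) ^ 2) ^ 2 = 3 / 16 := by
  have h_left : (Real.sin (Real.pi * ((1:ℝ)/6 + 1/3) / 2) ^ 2 -
      Real.sin (Real.pi * ((1:ℝ)/6) / 2) ^ 2) ^ 2 = 3 / 16 := by
    rw [sq_sin_sq_sub_sin_sq_eq,
      show Real.pi * ((1:ℝ)/6) - Real.pi / 3 = -(Real.pi / 6) by ring,
      Real.cos_neg, Real.sq_cos_pi_div_six]
    norm_num
  have h_right : (Real.sin (Real.pi * ((1:ℝ)/2 + 1/3) / 2) ^ 2 -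
      Real.sin (Real.pi * ((1:ℝ)/2) / 2) ^ 2) ^ 2 = 3 / 16 := by
    rw [sq_sin_sq_sub_sin_sq_eq,
      show Real.pi * ((1:ℝ)/2) - Real.pi / 3 = Real.pi / 6 by ring, Real.sq_cos_pi_div_six]
    norm_num
  refine ⟨IsLeast.csInf_eq ⟨⟨1/6, ⟨le_rfl, by norm_num⟩, h_left⟩, ?_⟩, h_left, h_right⟩
  rintro _ ⟨x, ⟨hx₁, hx₂⟩, rfl⟩
  have hπ := Real.pi_pos
  have hcos : √3 / 2 ≤ Real.cos (Real.pi * x - Real.pi / 3) :=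
    sqrt_three_div_two_le_cos (abs_le.mpr ⟨by nlinarith, by nlinarith⟩)
  have hsq := pow_le_pow_left₀ (by positivity) hcos 2
  rw [div_pow, Real.sq_sqrt (by norm_num)] at hsq
  simp only [sq_sin_sq_sub_sin_sq_eq]
  linarith
end
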